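/- Let S be an independent set in a finite simple graph G, let H := ⋃_{v∈S} G_v, and let c be the number of connected components of H. Then |N_G(S)| ≤ c + Σ_{v∈S} (deg_G(v) − 1). -/

import Mathlib

open SimpleGraph

/-- `Gv G v` is the subgraph of `G` induced by `{v} ∪ N_G(v)`. -/
def Gv {V : Type*} (G : SimpleGraph V) (v : V) : G.Subgraph :=
  (⊤ : G.Subgraph).induce ({v} ∪ G.neighborSet v)

/-- If any rational-valued function on the vertices that agrees on each pair `(s i, t i)` is
constant along the edges of `G`, then `G` has at least `|W| - |ι|` connected components. -/
theorem card_le_card_connectedComponent_add_card {W ι : Type*} [Finite W] [Finite ι]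
    (G : SimpleGraph W) (s t : ι → W)
    (h : ∀ f : W → ℚ, (∀ i, f (s i) = f (t i)) → ∀ a b, G.Adj a b → f a = f b) :
    Nat.card W ≤ Nat.card G.ConnectedComponent + Nat.card ι := by
  classical
  have := Fintype.ofFinite W
  have := Fintype.ofFinite ι
  have := Fintype.ofFinite G.ConnectedComponent
  let D : (W → ℚ) →ₗ[ℚ] (ι → ℚ) := LinearMap.funLeft ℚ ℚ s - LinearMap.funLeft ℚ ℚ t
  let P := LinearMap.funLeft ℚ ℚ G.connectedComponentMk
  have hker : LinearMap.ker D ≤ LinearMap.range P := by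
    intro f hf
    have hadj := h f fun i => sub_eq_zero.mp (congrFun hf i)
    have hreach {a b : W} (p : G.Walk a b) : f a = f b := by
      induction p with
      | nil => rfl
      | cons hab _ ih => exact (hadj _ _ hab).trans ih
    exact ⟨ConnectedComponent.lift f fun _ _ p _ => hreach p, rfl⟩
  have h₁ := D.finrank_range_add_finrank_ker
  have h₂ := (LinearMap.range D).finrank_le
  have h₃ := (Submodule.finrank_mono hker).trans P.finrank_range_le
  simp only [Module.finrank_fintype_fun_eq_card, ← Nat.card_eq_fintype_card] at h₁ h₂ h₃
  lia

/-- Inequality (6) of the paper: if `S` is an independent set of a finite simple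
graph `G`, `H := ⋃_{v ∈ S} G_v`, and `c` is the number of connected components
of `H`, then `|N_G(S)| ≤ c + Σ_{v ∈ S} (deg_G(v) - 1)`. -/
theorem neighbourhood_components_bound
    {V : Type*} [Fintype V] [DecidableEq V]
    (G : SimpleGraph V) [DecidableRel G.Adj]
    (S : Finset V)
    (hindep : ∀ u ∈ S, ∀ v ∈ S, ¬ G.Adj u v)
    (H : G.Subgraph) (hH : H = ⨆ v ∈ S, Gv G v)
    (c : ℕ) (hc : c = Nat.card H.coe.ConnectedComponent) :
    ((S.biUnion fun v => G.neighborFinset v).card : ℤ)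
      ≤ (c : ℤ) + ∑ v ∈ S, ((G.degree v : ℤ) - 1) := by
  classical
  subst hc
  have hverts : H.verts = ↑(S ∪ S.biUnion fun v => G.neighborFinset v) := by
    subst hH
    ext x
    simp only [Subgraph.verts_iSup, Gv, Subgraph.induce_verts, Set.mem_iUnion, Set.mem_union,
      Set.mem_singleton_iff, mem_neighborSet, Finset.coe_union, Finset.mem_coe,
      Finset.mem_biUnion, mem_neighborFinset]
    grind
  have hdisj : Disjoint S (S.biUnion fun v => G.neighborFinset v) := by
    simp only [Finset.disjoint_left, Finset.mem_biUnion, mem_neighborFinset]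
    rintro u hu ⟨v, hv, hvu⟩
    exact hindep v hv u hu hvu
  have hcard : Nat.card H.verts = S.card + (S.biUnion fun v => G.neighborFinset v).card := by
    rw [hverts, Nat.card_coe_set_eq, Set.ncard_coe_finset, Finset.card_union_of_disjoint hdisj]
  have hS (v : S) : v.1 ∈ H.verts := by simp [hverts]
  have hN (v : S) (u : G.neighborSet v) : u.1 ∈ H.verts := by
    rw [hverts]
    simp only [Finset.coe_union, Set.mem_union, Finset.mem_coe, Finset.mem_biUnion,
      mem_neighborFinset]
    exact .inr ⟨v, v.2, u.2⟩
  have key := card_le_card_connectedComponent_add_card H.coe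
    (fun i : Σ v : S, G.neighborSet v => (⟨i.1, hS i.1⟩ : H.verts))
    (fun i => ⟨i.2, hN i.1 i.2⟩) (by
      intro f hf a b hab
      have hstar (v : V) (hv : v ∈ S) (x : H.verts) (hx : x.1 = v ∨ G.Adj v x.1) :
          f x = f ⟨v, hS ⟨v, hv⟩⟩ := by
        rcases hx with rfl | hx
        · rfl
        · exact (hf ⟨⟨v, hv⟩, ⟨x.1, hx⟩⟩).symm
      have hab' : (⨆ v ∈ S, Gv G v).Adj a b := hH ▸ hab
      simp only [Subgraph.iSup_adj, Gv, Subgraph.induce_adj, Set.mem_union,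
        Set.mem_singleton_iff, mem_neighborSet] at hab'
      obtain ⟨v, hv, ha, hb, -⟩ := hab'
      rw [hstar v hv a ha, hstar v hv b hb])
  have hsum : Nat.card (Σ v : S, G.neighborSet v) = ∑ v ∈ S, G.degree v := by
    rw [Nat.card_sigma, ← Finset.sum_coe_sort S]
    simp only [Nat.card_eq_fintype_card, card_neighborSet_eq_degree]
  rw [hcard, hsum] at key
  zify at key
  rw [Finset.sum_sub_distrib]
  simp only [Finset.sum_const, nsmul_eq_mul, mul_one]
  linarith
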